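/- arXiv:2603.10972 — 5 statements merged into one kernel-verified Lean document; each statement's English description precedes it below -/
import Mathlib

section
/- Fix an integer N ≥ 6 and complex numbers c₄₀, c₂₀, c₁₀, c₁₁. On R_N := MvPolynomial (ZMod N) ℂ define H := Σ_i ( a†_i∘a_{i+1} + a†_{i+1}∘a_i + c₄₀·(a†_i)⁴ + c₂₀·(a†_i)² + c₁₀·a†_i + c₁₁·n_i ) and Q₃ := Σ_i ( a†_i∘a_{i+2} − a†_{i+2}∘a_i ) + 4c₄₀·Σ_i ( a†_i∘(a†_{i+1})³ − (a†_i)³∘a†_{i+1} ) + 4c₁₁·Σ_i ( a†_i∘a_{i+1} − a†_{i+1}∘a_i ). Then ⁅Q₃, H⁆ = 0; i.e., the degree-4 non-Hermitian bosonic chain possesses this 3-local conserved charge. -/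
open MvPolynomial

noncomputable section

/-- Creation operator at site `i` of the periodic bosonic chain:
multiplication by the variable `X i` on `MvPolynomial (ZMod N) ℂ`. -/
def ad (N : ℕ) (i : ZMod N) : Module.End ℂ (MvPolynomial (ZMod N) ℂ) :=
  LinearMap.mulLeft ℂ (X i)

/-- Annihilation operator at site `i`: the partial derivative `pderiv i`. -/
def an (N : ℕ) (i : ZMod N) : Module.End ℂ (MvPolynomial (ZMod N) ℂ) :=
  (pderiv i).toLinearMap

theorem sum_add_right_zmod {M : Type*} [AddCommMonoid M] (N : ℕ) [NeZero N] (g : ZMod N → M)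
    (k : ZMod N) : ∑ i, g (i + k) = ∑ i, g i :=
  Equiv.sum_comp (Equiv.addRight k) g

/-- The commutator of two first-order operators `D + P` with `D` a derivation. -/
theorem lie_derivation_add_mulLeft {σ : Type*}
    (D E : Derivation ℂ (MvPolynomial σ ℂ) (MvPolynomial σ ℂ)) (P Q : MvPolynomial σ ℂ)
    (hDE : ∀ j, D (E (X j)) = E (D (X j))) (hPQ : D Q = E P) :
    ⁅(D : Module.End ℂ (MvPolynomial σ ℂ)) + LinearMap.mulLeft ℂ P,
      (E : Module.End ℂ (MvPolynomial σ ℂ)) + LinearMap.mulLeft ℂ Q⁆ = 0 := by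
  have hcomm : ⁅D, E⁆ = 0 := by
    apply MvPolynomial.derivation_ext
    intro j
    simp [Derivation.commutator_apply, hDE]
  refine LinearMap.ext fun f => ?_
  have hf : D (E f) - E (D f) = 0 := by
    rw [← Derivation.commutator_apply, hcomm, Derivation.zero_apply]
  simp only [Ring.lie_def, LinearMap.sub_apply, Module.End.mul_apply, LinearMap.add_apply,
    LinearMap.mulLeft_apply, Derivation.coeFn_coe, map_add, Derivation.leibniz, smul_eq_mul,
    LinearMap.zero_apply]
  linear_combination hf + f * hPQ

/-- The derivation sending `X j` to `X (j - k)`, i.e. the hopping term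
`∑ i, ad N i * an N (i + k)`. -/
def hop (N : ℕ) (k : ZMod N) :
    Derivation ℂ (MvPolynomial (ZMod N) ℂ) (MvPolynomial (ZMod N) ℂ) :=
  mkDerivation ℂ fun j => X (j - k)

@[simp]
theorem hop_X (N : ℕ) (k j : ZMod N) : hop N k (X j) = X (j - k) :=
  mkDerivation_X _ _ _

theorem derivation_sum_apply {ι σ : Type*} (s : Finset ι)
    (D : ι → Derivation ℂ (MvPolynomial σ ℂ) (MvPolynomial σ ℂ)) (f : MvPolynomial σ ℂ) :
    (∑ i ∈ s, D i) f = ∑ i ∈ s, D i f := by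
  rw [← Finset.sum_apply]
  exact congrFun (map_sum Derivation.coeFnAddMonoidHom D s) f

theorem sum_ad_mul_an_add (N : ℕ) [NeZero N] (k : ZMod N) :
    ∑ i, ad N i * an N (i + k) = (hop N k : Module.End ℂ (MvPolynomial (ZMod N) ℂ)) := by
  have h : ∑ i : ZMod N, (X i : MvPolynomial (ZMod N) ℂ) • pderiv (R := ℂ) (i + k) = hop N k := by
    apply MvPolynomial.derivation_ext
    intro j
    rw [hop_X, derivation_sum_apply, Finset.sum_eq_single (j - k)]
    · simp
    · intro i _ hi
      have : j ≠ i + k := fun h => hi (by rw [h]; ring)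
      simp [pderiv_X_of_ne this]
    · simp
  rw [← h]
  refine LinearMap.ext fun f => ?_
  simp [ad, an, derivation_sum_apply, LinearMap.sum_apply]

theorem sum_ad_add_mul_an (N : ℕ) [NeZero N] (k : ZMod N) :
    ∑ i, ad N (i + k) * an N i = (hop N (-k) : Module.End ℂ (MvPolynomial (ZMod N) ℂ)) := by
  rw [← sum_ad_mul_an_add, ← sum_add_right_zmod N (fun i => ad N i * an N (i + -k)) k]
  simp

/-- The degree-4 non-Hermitian bosonic chain possesses the displayed
3-local conserved charge `Q₃`. -/
theorem degree4_three_local_charge (N : ℕ) [NeZero N] (hN : 6 ≤ N)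
    (c40 c20 c10 c11 : ℂ)
    (H Q3 : Module.End ℂ (MvPolynomial (ZMod N) ℂ))
    (hH : H = ∑ i : ZMod N,
        (ad N i * an N (i + 1) + ad N (i + 1) * an N i
          + c40 • (ad N i) ^ 4 + c20 • (ad N i) ^ 2 + c10 • ad N i
          + c11 • (ad N i * an N i)))
    (hQ : Q3 = (∑ i : ZMod N, (ad N i * an N (i + 2) - ad N (i + 2) * an N i))
        + (4 * c40) • ∑ i : ZMod N,
            (ad N i * (ad N (i + 1)) ^ 3 - (ad N i) ^ 3 * ad N (i + 1))
        + (4 * c11) • ∑ i : ZMod N,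
            (ad N i * an N (i + 1) - ad N (i + 1) * an N i)) :
    ⁅Q3, H⁆ = 0 := by
  have hH' : H = ((hop N 1 + hop N (-1) + c11 • hop N 0 :
        Derivation ℂ (MvPolynomial (ZMod N) ℂ) (MvPolynomial (ZMod N) ℂ)) :
          Module.End ℂ (MvPolynomial (ZMod N) ℂ))
      + LinearMap.mulLeft ℂ (∑ i : ZMod N, (C c40 * X i ^ 4 + C c20 * X i ^ 2 + C c10 * X i)) := by
    have h0 := sum_ad_mul_an_add N 0
    simp only [add_zero] at h0
    rw [hH]
    simp only [Finset.sum_add_distrib, ← Finset.smul_sum, sum_ad_mul_an_add, sum_ad_add_mul_an, h0]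
    refine LinearMap.ext fun f => ?_
    simp [ad, LinearMap.pow_mulLeft, LinearMap.sum_apply, smul_eq_C_mul, Finset.sum_mul,
      Finset.mul_sum, add_mul, mul_assoc]
    ring
  have hQ' : Q3 = ((hop N 2 - hop N (-2) + (4 * c11) • (hop N 1 - hop N (-1)) :
        Derivation ℂ (MvPolynomial (ZMod N) ℂ) (MvPolynomial (ZMod N) ℂ)) :
          Module.End ℂ (MvPolynomial (ZMod N) ℂ))
      + LinearMap.mulLeft ℂ (∑ i : ZMod N,
          C (4 * c40) * (X i * X (i + 1) ^ 3 - X i ^ 3 * X (i + 1))) := by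
    rw [hQ]
    simp only [Finset.sum_sub_distrib, sum_ad_mul_an_add, sum_ad_add_mul_an]
    refine LinearMap.ext fun f => ?_
    simp [ad, LinearMap.sum_apply, smul_eq_C_mul, Finset.sum_mul,
      Finset.mul_sum, sub_mul, mul_sub, Finset.sum_sub_distrib, mul_assoc]
    ring
  rw [hH', hQ']
  apply lie_derivation_add_mulLeft
  · intro j
    simp [smul_eq_C_mul]
    ring_nf
  · rw [← sub_eq_zero]
    let x : ZMod N → MvPolynomial (ZMod N) ℂ := X
    let a : ZMod N → MvPolynomial (ZMod N) ℂ := fun i =>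
      C c40 * (4 * x i ^ 3 * x (i - 2) + 4 * x i ^ 4 + 12 * x i ^ 2 * x (i - 1) * x (i + 1))
        + 16 * C c40 * C c11 * x i ^ 3 * x (i - 1) + 8 * C c20 * C c11 * x i * x (i - 1)
    let b : ZMod N → MvPolynomial (ZMod N) ℂ := fun i =>
      2 * C c20 * x i * x (i - 2) + 4 * C c10 * C c11 * x (i - 1)
    let c : ZMod N → MvPolynomial (ZMod N) ℂ := fun i => C c10 * x (i - 2)
    have key : ∑ i, ((a i - a (i + 1)) + (b i - b (i + 2)) + (c i - c (i + 4))) = 0 := by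
      simp only [Finset.sum_add_distrib, Finset.sum_sub_distrib, sum_add_right_zmod, sub_self,
        add_zero]
    rw [← key, map_sum, map_sum, ← Finset.sum_sub_distrib]
    refine Finset.sum_congr rfl fun i _ => ?_
    have e1 : i + 1 - 2 = i - 1 := by ring
    have e2 : i + 1 + 1 = i + 2 := by ring
    have e3 : i + 2 - 1 = i + 1 := by ring
    have e4 : i + 4 - 2 = i + 2 := by ring
    have h4 : (C 4 : MvPolynomial (ZMod N) ℂ) = 4 := map_ofNat C 4
    have hop4 (k : ZMod N) : hop N k 4 = 0 := by
      rw [← h4]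
      exact Derivation.map_algebraMap (hop N k) (4 : ℂ)
    simp [a, b, c, x, Derivation.leibniz, Derivation.leibniz_pow, smul_eq_C_mul, e1, e2, e3, e4, h4, hop4]
    ring

end
end

section
/- Fix an integer N ≥ 10 and complex numbers c₃₀, c₁₁, c₀₁. On R_N := MvPolynomial (ZMod N) ℂ define H := Σ_i ( a†_i∘a_{i+1} + a†_{i+1}∘a_i + c₃₀·(a†_i)³ + c₁₁·n_i + c₀₁·a_i ) and Q₅ := Σ_i [ a†_i∘a_{i+4} − a†_{i+4}∘a_i + 3c₃₀·( a†_i∘(a†_{i+3})² − (a†_i)²∘a†_{i+3} ) − 6c₃₀·( a†_i∘a†_{i+2}∘a†_{i+3} − a†_i∘a†_{i+1}∘a†_{i+3} ) + 2(3c₁₁ − 2)·( a†_i∘a_{i+3} − a†_{i+3}∘a_i ) + 3c₃₀(3c₁₁ − 2)·( a†_i∘(a†_{i+2})² − (a†_i)²∘a†_{i+2} ) − 3c₃₀(9c₁₁² − 6c₁₁ − 1)·( a†_i∘(a†_{i+1})² − (a†_i)²∘a†_{i+1} ) − (27c₁₁³ − 36c₁₁² + 6c₁₁ + 4)·( a†_i∘a_{i+1}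 − a†_{i+1}∘a_i ) ]. Then ⁅Q₅, H⁆ = 0; i.e., the partially integrable (Type C⁻) model possesses this 5-local conserved charge. -/
open MvPolynomial

noncomputable section

section ChainDerivations

variable {N : ℕ}

/-- The variable at integer distance `k` from the site `i`. -/
def siteVar (i : ZMod N) (k : ℤ) : MvPolynomial (ZMod N) ℂ := X (i + (k : ZMod N))

/-- The translation-invariant cubic polynomial `∑ i, x_i x_{i+u} x_{i+v}`. -/
def tripleSum (N : ℕ) [NeZero N] (u v : ℤ) : MvPolynomial (ZMod N) ℂ :=
  ∑ i : ZMod N, siteVar i 0 * siteVar i u * siteVar i v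

/-- The translation-invariant quadratic polynomial `∑ i, x_i x_{i+u}`. -/
def pairSum (N : ℕ) [NeZero N] (u : ℤ) : MvPolynomial (ZMod N) ℂ :=
  ∑ i : ZMod N, siteVar i 0 * siteVar i u

/-- The first-order part of the Hamiltonian. -/
def nearestHop (N : ℕ) (b d : ℂ) :
    Derivation ℂ (MvPolynomial (ZMod N) ℂ) (MvPolynomial (ZMod N) ℂ) :=
  mkDerivation ℂ fun j => siteVar j (-1) + siteVar j 1 + C b * siteVar j 0 + C d

/-- The first-order part of the charge: antisymmetric hopping over distances `4`, `3` and `1`. -/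
def antiHop (N : ℕ) (β γ : ℂ) :
    Derivation ℂ (MvPolynomial (ZMod N) ℂ) (MvPolynomial (ZMod N) ℂ) :=
  mkDerivation ℂ fun j => siteVar j (-4) - siteVar j 4
    + C β * (siteVar j (-3) - siteVar j 3) + C γ * (siteVar j (-1) - siteVar j 1)

theorem siteVar_add (i : ZMod N) (k l : ℤ) :
    siteVar (i + (k : ZMod N)) l = siteVar i (k + l) := by
  simp [siteVar, add_assoc]

theorem nearestHop_siteVar (b d : ℂ) (i : ZMod N) (k : ℤ) :
    nearestHop N b d (siteVar i k)
      = siteVar i (k - 1) + siteVar i (k + 1) + C b * siteVar i k + C d := by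
  rw [nearestHop, siteVar, mkDerivation_X]
  simp only [siteVar_add, sub_eq_add_neg, add_zero]
  rfl

theorem antiHop_siteVar (β γ : ℂ) (i : ZMod N) (k : ℤ) :
    antiHop N β γ (siteVar i k) = siteVar i (k - 4) - siteVar i (k + 4)
      + C β * (siteVar i (k - 3) - siteVar i (k + 3))
      + C γ * (siteVar i (k - 1) - siteVar i (k + 1)) := by
  rw [antiHop, siteVar, mkDerivation_X]
  simp only [siteVar_add, sub_eq_add_neg]

theorem derivation_C_mul (D : Derivation ℂ (MvPolynomial (ZMod N) ℂ) (MvPolynomial (ZMod N) ℂ))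
    (a : ℂ) (p : MvPolynomial (ZMod N) ℂ) : D (C a * p) = C a * D p := by
  rw [← smul_eq_C_mul, D.map_smul, smul_eq_C_mul]

theorem lie_antiHop_nearestHop (b d β γ : ℂ) :
    ⁅antiHop N β γ, nearestHop N b d⁆ = 0 := by
  refine MvPolynomial.derivation_ext fun j => ?_
  have hj : (X j : MvPolynomial (ZMod N) ℂ) = siteVar j 0 := by simp [siteVar]
  rw [Derivation.commutator_apply, hj]
  simp only [nearestHop_siteVar, antiHop_siteVar, map_add, map_sub, derivation_C_mul,
    derivation_C, Derivation.coe_zero, Pi.zero_apply]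
  norm_num
  ring

variable [NeZero N]

theorem sum_comp_site_add (f : ZMod N → MvPolynomial (ZMod N) ℂ) (k : ZMod N) :
    ∑ i, f (i + k) = ∑ i, f i :=
  Equiv.sum_comp (Equiv.addRight k) f

theorem sum_siteVar_triple (a b c : ℤ) :
    ∑ i : ZMod N, siteVar i a * siteVar i b * siteVar i c = tripleSum N (b - a) (c - a) := by
  rw [tripleSum, ← sum_comp_site_add
    (fun i => siteVar i 0 * siteVar i (b - a) * siteVar i (c - a)) (a : ZMod N)]
  simp only [siteVar_add, add_zero, add_sub_cancel]

theorem sum_siteVar_pair (a b : ℤ) :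
    ∑ i : ZMod N, siteVar i a * siteVar i b = pairSum N (b - a) := by
  rw [pairSum, ← sum_comp_site_add (fun i => siteVar i 0 * siteVar i (b - a)) (a : ZMod N)]
  simp only [siteVar_add, add_zero, add_sub_cancel]

theorem tripleSum_comm (u v : ℤ) : tripleSum N u v = tripleSum N v u :=
  Finset.sum_congr rfl fun _ _ => by ring

theorem tripleSum_neg (u v : ℤ) : tripleSum N u v = tripleSum N (-u) (v - u) := by
  rw [← zero_sub u, ← sum_siteVar_triple]
  exact Finset.sum_congr rfl fun _ _ => by ring

theorem nearestHop_tripleSum (b d : ℂ) (u v : ℤ) :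
    nearestHop N b d (tripleSum N u v)
      = tripleSum N (u + 1) (v + 1) + tripleSum N (u - 1) (v - 1)
        + tripleSum N (u - 1) v + tripleSum N (u + 1) v
        + tripleSum N u (v - 1) + tripleSum N u (v + 1)
        + C (3 * b) * tripleSum N u v
        + C d * (pairSum N u + pairSum N v + pairSum N (v - u)) := by
  have h1 : tripleSum N (u + 1) (v + 1)
      = ∑ i : ZMod N, siteVar i (-1) * siteVar i u * siteVar i v := by
    rw [sum_siteVar_triple, sub_neg_eq_add, sub_neg_eq_add]
  have h2 : tripleSum N (u - 1) (v - 1)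
      = ∑ i : ZMod N, siteVar i 1 * siteVar i u * siteVar i v := by
    rw [sum_siteVar_triple]
  rw [h1, h2, ← sum_siteVar_pair u v]
  simp only [tripleSum, pairSum, map_sum, Finset.mul_sum, ← Finset.sum_add_distrib]
  refine Finset.sum_congr rfl fun i _ => ?_
  simp only [Derivation.leibniz, smul_eq_mul, nearestHop_siteVar, zero_sub, zero_add, map_mul,
    map_ofNat]
  ring

theorem antiHop_tripleSum_zero (β γ : ℂ) :
    antiHop N β γ (tripleSum N 0 0)
      = 3 * (tripleSum N 4 4 - tripleSum N 0 4 + C β * (tripleSum N 3 3 - tripleSum N 0 3)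
        + C γ * (tripleSum N 1 1 - tripleSum N 0 1)) := by
  have h (k : ℤ) : tripleSum N k k
      = ∑ i : ZMod N, siteVar i (-k) * siteVar i 0 * siteVar i 0 := by
    rw [sum_siteVar_triple, zero_sub, neg_neg]
  rw [h 4, h 3, h 1]
  simp only [tripleSum, map_sum, Finset.mul_sum, ← Finset.sum_add_distrib,
    ← Finset.sum_sub_distrib]
  refine Finset.sum_congr rfl fun i _ => ?_
  simp only [Derivation.leibniz, smul_eq_mul, antiHop_siteVar, zero_sub, zero_add]
  ring

theorem mkDerivation_eq_sum (f : ZMod N → MvPolynomial (ZMod N) ℂ)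
    (p : MvPolynomial (ZMod N) ℂ) :
    mkDerivation ℂ f p = ∑ j, f j * pderiv j p := by
  have hsum (q : MvPolynomial (ZMod N) ℂ) :
      (∑ j, f j • pderiv j : Derivation ℂ _ (MvPolynomial (ZMod N) ℂ)) q
        = ∑ j, f j * pderiv j q := by
    rw [← Derivation.coeFnAddMonoidHom_apply, map_sum, Finset.sum_apply]
    rfl
  rw [← hsum]
  refine DFunLike.congr_fun (MvPolynomial.derivation_ext fun k => ?_) p
  rw [mkDerivation_X, hsum]
  simp [pderiv_X, Pi.single_apply]

theorem sum_forward_hop (k : ℤ) (p : MvPolynomial (ZMod N) ℂ) :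
    ∑ i, siteVar i (-k) * pderiv i p = ∑ i, X i * pderiv (i + (k : ZMod N)) p := by
  rw [← sum_comp_site_add (fun i => siteVar i (-k) * pderiv i p) (k : ZMod N)]
  simp [siteVar]

theorem nearestHop_apply (b d : ℂ) (p : MvPolynomial (ZMod N) ℂ) :
    nearestHop N b d p = ∑ i, (X i * pderiv (i + 1) p + X (i + 1) * pderiv i p
      + b • (X i * pderiv i p) + d • pderiv i p) := by
  have h1 := sum_forward_hop 1 p
  rw [Int.cast_one] at h1
  rw [nearestHop, mkDerivation_eq_sum]
  simp only [add_mul, Finset.sum_add_distrib, h1, smul_eq_C_mul, mul_assoc]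
  simp [siteVar]

theorem antiHop_apply (β γ : ℂ) (p : MvPolynomial (ZMod N) ℂ) :
    antiHop N β γ p = ∑ i, (X i * pderiv (i + 4) p - X (i + 4) * pderiv i p
      + β • (X i * pderiv (i + 3) p - X (i + 3) * pderiv i p)
      + γ • (X i * pderiv (i + 1) p - X (i + 1) * pderiv i p)) := by
  have h1 := sum_forward_hop 1 p
  have h3 := sum_forward_hop 3 p
  have h4 := sum_forward_hop 4 p
  rw [Int.cast_one] at h1
  rw [Int.cast_ofNat] at h3 h4
  rw [antiHop, mkDerivation_eq_sum]
  simp only [add_mul, sub_mul, mul_assoc, Finset.sum_add_distrib, Finset.sum_sub_distrib,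
    ← Finset.mul_sum, h1, h3, h4, smul_eq_C_mul]
  simp [siteVar]

/-- The cubic potential of the charge. -/
def chargePotential (N : ℕ) [NeZero N] (a b : ℂ) : MvPolynomial (ZMod N) ℂ :=
  C (3 * a) * (tripleSum N 3 3 - tripleSum N 0 3)
    - C (6 * a) * (tripleSum N 2 3 - tripleSum N 1 3)
    + C (3 * a * (3 * b - 2)) * (tripleSum N 2 2 - tripleSum N 0 2)
    - C (3 * a * (9 * b ^ 2 - 6 * b - 1)) * (tripleSum N 1 1 - tripleSum N 0 1)

theorem antiHop_potential_eq (a b d : ℂ) :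
    antiHop N (2 * (3 * b - 2)) (-(27 * b ^ 3 - 36 * b ^ 2 + 6 * b + 4))
        (C a * tripleSum N 0 0)
      = nearestHop N b d (chargePotential N a b) := by
  have neg1 (v : ℤ) : tripleSum N (-1) v = tripleSum N 1 (v + 1) := by
    rw [tripleSum_neg, neg_neg, sub_neg_eq_add]
  simp only [chargePotential, derivation_C_mul, map_add, map_sub, nearestHop_tripleSum,
    antiHop_tripleSum_zero]
  simp only [map_add, map_sub, map_mul, map_neg, map_pow, map_ofNat, map_one]
  norm_num [neg1]
  simp only [tripleSum_comm (N := N) 3 2, tripleSum_comm (N := N) 4 3,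
    tripleSum_comm (N := N) 2 1, tripleSum_comm (N := N) 1 0]
  ring

end ChainDerivations

/-- The partially integrable (Type C⁻) degree-3 model possesses the displayed
5-local conserved charge `Q₅`. -/
theorem typeCminus_five_local_charge (N : ℕ) [NeZero N] (hN : 10 ≤ N)
    (c30 c11 c01 : ℂ)
    (H Q5 : Module.End ℂ (MvPolynomial (ZMod N) ℂ))
    (hH : H = ∑ i : ZMod N,
        (ad N i * an N (i + 1) + ad N (i + 1) * an N i
          + c30 • (ad N i) ^ 3 + c11 • (ad N i * an N i) + c01 • an N i))
    (hQ : Q5 = ∑ i : ZMod N,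
        (ad N i * an N (i + 4) - ad N (i + 4) * an N i
          + (3 * c30) • (ad N i * (ad N (i + 3)) ^ 2 - (ad N i) ^ 2 * ad N (i + 3))
          - (6 * c30) • (ad N i * ad N (i + 2) * ad N (i + 3)
              - ad N i * ad N (i + 1) * ad N (i + 3))
          + (2 * (3 * c11 - 2)) • (ad N i * an N (i + 3) - ad N (i + 3) * an N i)
          + (3 * c30 * (3 * c11 - 2)) •
              (ad N i * (ad N (i + 2)) ^ 2 - (ad N i) ^ 2 * ad N (i + 2))
          - (3 * c30 * (9 * c11 ^ 2 - 6 * c11 - 1)) •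
              (ad N i * (ad N (i + 1)) ^ 2 - (ad N i) ^ 2 * ad N (i + 1))
          - (27 * c11 ^ 3 - 36 * c11 ^ 2 + 6 * c11 + 4) •
              (ad N i * an N (i + 1) - ad N (i + 1) * an N i))) :
    ⁅Q5, H⁆ = 0 := by
  have hHp (p) : H p = nearestHop N c11 c01 p + C c30 * tripleSum N 0 0 * p := by
    rw [hH, nearestHop_apply, tripleSum, Finset.mul_sum, Finset.sum_mul,
      ← Finset.sum_add_distrib, LinearMap.sum_apply]
    refine Finset.sum_congr rfl fun i _ => ?_
    simp [ad, an, siteVar, smul_eq_C_mul, pow_succ]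
    ring
  have hQp (p) : Q5 p =
      antiHop N (2 * (3 * c11 - 2)) (-(27 * c11 ^ 3 - 36 * c11 ^ 2 + 6 * c11 + 4)) p
        + chargePotential N c30 c11 * p := by
    rw [hQ, antiHop_apply, chargePotential]
    simp only [tripleSum, ← Finset.sum_sub_distrib, Finset.mul_sum, Finset.sum_mul,
      ← Finset.sum_add_distrib, LinearMap.sum_apply]
    refine Finset.sum_congr rfl fun i _ => ?_
    simp [ad, an, siteVar, smul_eq_C_mul, pow_succ]
    ring
  refine LinearMap.ext fun p => ?_
  have hlie := DFunLike.congr_fun (lie_antiHop_nearestHop (N := N) c11 c01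
    (2 * (3 * c11 - 2)) (-(27 * c11 ^ 3 - 36 * c11 ^ 2 + 6 * c11 + 4))) p
  have hpot := antiHop_potential_eq (N := N) c30 c11 c01
  rw [Derivation.commutator_apply, Derivation.coe_zero, Pi.zero_apply] at hlie
  rw [Ring.lie_def, LinearMap.sub_apply, Module.End.mul_apply, Module.End.mul_apply,
    LinearMap.zero_apply]
  simp only [hHp, hQp, map_add, Derivation.leibniz _ (_ * _) p,
    Derivation.leibniz _ (chargePotential N c30 c11) p, smul_eq_mul, hpot]
  linear_combination hlie

end
end

section
/- Fix integers N and k with 3 ≤ k and 2k ≤ N, and complex numbers c₂₀, c₁₀, c₁₁, c₀₁, c₀₂. On R_N := MvPolynomial (ZMod N) ℂ define H := Σ_i ( a†_i∘a_{i+1} + a†_{i+1}∘a_i + c₂₀·(a†_i)² + c₁₀·a†_i + c₁₁·n_i + c₀₁·a_i + c₀₂·(a_i)² ) and Q := Σ_i ( a†_i∘a_{i+k−1} − a†_{i+k−1}∘a_i ). Then ⁅Q, H⁆ = 0; i.e., every bosonic chain whose on-site term has degree at most 2 possesses the antisymmetric k-local charge Σ_i (b†_i b_{i+k−1} − b_i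 b†_{i+k−1}) for every k with 3 ≤ k ≤ N/2. -/
open MvPolynomial

noncomputable section

theorem ring_lie_mul {A : Type*} [Ring A] (q x y : A) : ⁅q, x * y⁆ = ⁅q, x⁆ * y + x * ⁅q, y⁆ := by
  simp only [Ring.lie_def]
  noncomm_ring

theorem ring_mul_lie {A : Type*} [Ring A] (x y z : A) : ⁅x * y, z⁆ = x * ⁅y, z⁆ + ⁅x, z⁆ * y := by
  simp only [Ring.lie_def]
  noncomm_ring

theorem ring_lie_add {A : Type*} [Ring A] (q x y : A) : ⁅q, x + y⁆ = ⁅q, x⁆ + ⁅q, y⁆ := by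
  simp only [Ring.lie_def]
  noncomm_ring

theorem ring_lie_smul {R A : Type*} [CommRing R] [Ring A] [Algebra R A] (c : R) (q x : A) :
    ⁅q, c • x⁆ = c • ⁅q, x⁆ := by
  simp only [Ring.lie_def, mul_smul_comm, smul_mul_assoc, smul_sub]

theorem ring_lie_sum {ι A : Type*} [Ring A] (s : Finset ι) (q : A) (f : ι → A) :
    ⁅q, ∑ i ∈ s, f i⁆ = ∑ i ∈ s, ⁅q, f i⁆ := by
  simp only [Ring.lie_def, Finset.mul_sum, Finset.sum_mul, Finset.sum_sub_distrib]

theorem ring_sum_lie {ι A : Type*} [Ring A] (s : Finset ι) (f : ι → A) (q : A) :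
    ⁅∑ i ∈ s, f i, q⁆ = ∑ i ∈ s, ⁅f i, q⁆ := by
  simp only [Ring.lie_def, Finset.mul_sum, Finset.sum_mul, Finset.sum_sub_distrib]

theorem ring_sub_lie {A : Type*} [Ring A] (x y q : A) : ⁅x - y, q⁆ = ⁅x, q⁆ - ⁅y, q⁆ := by
  simp only [Ring.lie_def]
  noncomm_ring

/-- If `⁅q, ·⁆` acts on two site-indexed families as the antisymmetric shift by `d`, then `q`
commutes with the sum over all sites of their product. -/
theorem lie_sum_mul_eq_zero {G A : Type*} [AddCommGroup G] [Fintype G] [Ring A] (q : A) (d : G)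
    (f g : G → A) (hf : ∀ j, ⁅q, f j⁆ = f (j - d) - f (j + d))
    (hg : ∀ j, ⁅q, g j⁆ = g (j - d) - g (j + d)) : ⁅q, ∑ j, f j * g j⁆ = 0 := by
  have h1 : ∑ j, f (j - d) * g j = ∑ j, f j * g (j + d) :=
    Fintype.sum_equiv (Equiv.subRight d) _ _ fun j => by simp
  have h2 : ∑ j, f (j + d) * g j = ∑ j, f j * g (j - d) :=
    Fintype.sum_equiv (Equiv.addRight d) _ _ fun j => by simp
  simp only [ring_lie_sum, ring_lie_mul, hf, hg, sub_mul, mul_sub, Finset.sum_add_distrib,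
    Finset.sum_sub_distrib, h1, h2]
  abel

theorem lie_sum_eq_zero {G A : Type*} [AddCommGroup G] [Fintype G] [Ring A] (q : A) (d : G)
    (f : G → A) (hf : ∀ j, ⁅q, f j⁆ = f (j - d) - f (j + d)) : ⁅q, ∑ j, f j⁆ = 0 := by
  simpa using lie_sum_mul_eq_zero q d f (fun _ => 1) hf fun _ => by simp [Ring.lie_def]

section CanonicalCommutation

variable {G A : Type*} [AddCommGroup G] [Fintype G] [DecidableEq G] [Ring A]

/-- The antisymmetric hopping operator of range `d` built from creation operators `c` and
annihilation operators `a`. -/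
def hopping (c a : G → A) (d : G) : A :=
  ∑ i, (c i * a (i + d) - c (i + d) * a i)

theorem lie_hopping_creation {c a : G → A} (hcc : ∀ i j, ⁅c i, c j⁆ = 0)
    (hac : ∀ i j, ⁅a i, c j⁆ = if i = j then 1 else 0) (d j : G) :
    ⁅hopping c a d, c j⁆ = c (j - d) - c (j + d) := by
  simp [hopping, ring_sum_lie, ring_sub_lie, ring_mul_lie, hcc, hac, ← eq_sub_iff_add_eq]

theorem lie_hopping_annihilation {c a : G → A} (haa : ∀ i j, ⁅a i, a j⁆ = 0)
    (hac : ∀ i j, ⁅a i, c j⁆ = if i = j then 1 else 0) (d j : G) :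
    ⁅hopping c a d, a j⁆ = a (j - d) - a (j + d) := by
  have hca : ∀ i j, ⁅c i, a j⁆ = -(if j = i then 1 else 0) := fun i j => by
    rw [← hac, Ring.lie_def, Ring.lie_def, neg_sub]
  simp [hopping, ring_sum_lie, ring_sub_lie, ring_mul_lie, haa, hca, ← sub_eq_iff_eq_add]
  abel

/-- For operators satisfying the canonical commutation relations, the antisymmetric hopping
operator of any range commutes with every translation-invariant chain with symmetric
nearest-neighbour hopping along `e` and on-site terms of degree at most two. -/
theorem lie_hopping_quadratic {R : Type*} [CommRing R] [Algebra R A] {c a : G → A}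
    (hcc : ∀ i j, ⁅c i, c j⁆ = 0) (haa : ∀ i j, ⁅a i, a j⁆ = 0)
    (hac : ∀ i j, ⁅a i, c j⁆ = if i = j then 1 else 0) (d e : G) (c20 c10 c11 c01 c02 : R) :
    ⁅hopping c a d, ∑ i, (c i * a (i + e) + c (i + e) * a i + c20 • (c i) ^ 2 + c10 • c i
      + c11 • (c i * a i) + c01 • a i + c02 • (a i) ^ 2)⁆ = 0 := by
  have hc := lie_hopping_creation hcc hac d
  have ha := lie_hopping_annihilation haa hac d
  have hc' : ∀ j, ⁅hopping c a d, c (j + e)⁆ = c (j - d + e) - c (j + d + e) := fun j => by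
    rw [hc, sub_add_eq_add_sub, add_right_comm]
  have ha' : ∀ j, ⁅hopping c a d, a (j + e)⁆ = a (j - d + e) - a (j + d + e) := fun j => by
    rw [ha, sub_add_eq_add_sub, add_right_comm]
  simp only [Finset.sum_add_distrib, ← Finset.smul_sum, ring_lie_add, ring_lie_smul, pow_two]
  rw [lie_sum_mul_eq_zero _ d _ (fun j => a (j + e)) hc ha',
    lie_sum_mul_eq_zero _ d (fun j => c (j + e)) _ hc' ha,
    lie_sum_mul_eq_zero _ d _ _ hc hc, lie_sum_eq_zero _ d _ hc,
    lie_sum_mul_eq_zero _ d _ _ hc ha, lie_sum_eq_zero _ d _ ha,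
    lie_sum_mul_eq_zero _ d _ _ ha ha]
  simp

end CanonicalCommutation

theorem lie_ad_ad (N : ℕ) (i j : ZMod N) : ⁅ad N i, ad N j⁆ = 0 := by
  rw [Ring.lie_def, sub_eq_zero]
  refine LinearMap.ext fun p => ?_
  simp only [ad, Module.End.mul_apply, LinearMap.mulLeft_apply]
  ring

theorem lie_an_an (N : ℕ) (i j : ZMod N) : ⁅an N i, an N j⁆ = 0 := by
  have h : ⁅(pderiv i : Derivation ℂ (MvPolynomial (ZMod N) ℂ) (MvPolynomial (ZMod N) ℂ)),
      (pderiv j : Derivation ℂ (MvPolynomial (ZMod N) ℂ) (MvPolynomial (ZMod N) ℂ))⁆ = 0 := by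
    refine MvPolynomial.derivation_ext fun l => ?_
    classical
    simp [Derivation.commutator_apply, pderiv_X, Pi.single_apply, apply_ite]
  refine LinearMap.ext fun p => ?_
  simpa [Derivation.commutator_apply, an, Ring.lie_def] using DFunLike.congr_fun h p

theorem lie_an_ad (N : ℕ) (i j : ZMod N) : ⁅an N i, ad N j⁆ = if i = j then 1 else 0 := by
  refine LinearMap.ext fun p => ?_
  rcases eq_or_ne i j with rfl | h
  · simp [an, ad, Ring.lie_def]
  · simp [an, ad, Ring.lie_def, pderiv_X_of_ne h.symm, h]

/-- Every bosonic chain whose on-site term has degree at most 2 possesses the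
antisymmetric k-local charge `Σ_i (b†_i b_{i+k−1} − b_i b†_{i+k−1})`
for every `3 ≤ k ≤ N/2`. -/
theorem degree2_antisymmetric_charge (N k : ℕ) [NeZero N]
    (hk : 3 ≤ k) (hkN : 2 * k ≤ N)
    (c20 c10 c11 c01 c02 : ℂ)
    (H Q : Module.End ℂ (MvPolynomial (ZMod N) ℂ))
    (hH : H = ∑ i : ZMod N,
        (ad N i * an N (i + 1) + ad N (i + 1) * an N i
          + c20 • (ad N i) ^ 2 + c10 • ad N i + c11 • (ad N i * an N i)
          + c01 • an N i + c02 • (an N i) ^ 2))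
    (hQ : Q = ∑ i : ZMod N,
        (ad N i * an N (i + ((k - 1 : ℕ) : ZMod N))
          - ad N (i + ((k - 1 : ℕ) : ZMod N)) * an N i)) :
    ⁅Q, H⁆ = 0 := by
  subst hH hQ
  exact lie_hopping_quadratic (lie_ad_ad N) (lie_an_an N) (lie_an_ad N) _ 1 c20 c10 c11 c01 c02

end
end

section
/- Let N be an even integer with N ≥ 6, let k satisfy 3 ≤ k and 2k ≤ N, let M ∈ ℕ, and let c₁₀, c₂₀, …, c_{M0}, c₀₁ ∈ ℂ. On R_N := MvPolynomial (ZMod N) ℂ define H := Σ_i ( a†_i∘a_{i+1} + a†_{i+1}∘a_i + Σ_{x=1}^{M} c_{x0}·(a†_i)^x + c₀₁·a_i ). Define Q_k := Σ_i (−1)^i · a†_i∘a†_{i+k−1} if k is even, and Q_k := Σ_i (−1)^i · ( a†_i∘a†_{i+k−1} − (a†_i)² ) if k is odd, where (−1)^i is the parity character of ZMod N (well defined since N is even). Then ⁅Q_k, H⁆ = 0; i.e., these models possess staggered k-local charges for every 3 ≤ k ≤ N/2 when N is even. -/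
open MvPolynomial

noncomputable section

/-- The staggered sign `(−1)^i` (the parity character of `ZMod N`,
well defined as a character when `N` is even). -/
def stag (N : ℕ) [NeZero N] (i : ZMod N) : ℂ := (-1 : ℂ) ^ i.val

/-- The derivation part of the Hamiltonian: symmetric hopping plus the term linear in `an`. -/
def hopDerivation (N : ℕ) [NeZero N] (c : ℂ) :
    Derivation ℂ (MvPolynomial (ZMod N) ℂ) (MvPolynomial (ZMod N) ℂ) :=
  ∑ i : ZMod N, ((X i : MvPolynomial (ZMod N) ℂ) • pderiv (i + 1)
    + (X (i + 1) : MvPolynomial (ZMod N) ℂ) • pderiv i + c • pderiv i)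

theorem hopDerivation_apply (N : ℕ) [NeZero N] (c : ℂ) (f : MvPolynomial (ZMod N) ℂ) :
    hopDerivation N c f = ∑ i : ZMod N,
      (X i * pderiv (i + 1) f + X (i + 1) * pderiv i f + c • pderiv i f) := by
  rw [hopDerivation, ← Derivation.coeFnAddMonoidHom_apply, map_sum, Finset.sum_apply]
  simp

theorem hopDerivation_X (N : ℕ) [NeZero N] (c : ℂ) (j : ZMod N) :
    hopDerivation N c (X j) = X (j - 1) + X (j + 1) + C c := by
  have h : ∀ i : ZMod N, (j = i + 1) = (j - 1 = i) := fun i => by rw [sub_eq_iff_eq_add]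
  simp [hopDerivation_apply, pderiv_X, Pi.single_apply, Finset.sum_add_distrib, h,
    smul_eq_C_mul]

theorem stag_add_one {N : ℕ} [NeZero N] (hN : Even N) (i : ZMod N) :
    stag N (i + 1) = -stag N i := by
  have h : (i + 1).val % 2 = (i.val + 1) % 2 := by
    rw [← Nat.cast_one, ← ZMod.natCast_zmod_val i, ← Nat.cast_add, ZMod.val_natCast,
      Nat.mod_mod_of_dvd _ hN.two_dvd, ZMod.natCast_zmod_val]
  rw [stag, stag, neg_one_pow_eq_pow_mod_two, h, ← neg_one_pow_eq_pow_mod_two, pow_succ,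
    mul_neg_one]

theorem sum_stag_smul_add_one {N : ℕ} [NeZero N] (hN : Even N) {M : Type*} [AddCommGroup M]
    [Module ℂ M] (f : ZMod N → M) :
    ∑ i, stag N i • f (i + 1) = -∑ i, stag N i • f i := by
  rw [← Equiv.sum_comp (Equiv.addRight (1 : ZMod N)) fun i => stag N i • f i]
  simp [stag_add_one hN]

theorem sum_stag_smul_add_natCast {N : ℕ} [NeZero N] (hN : Even N) {M : Type*}
    [AddCommGroup M] [Module ℂ M] (m : ℕ) (f : ZMod N → M) :
    ∑ i, stag N i • f (i + m) = (-1 : ℂ) ^ m • ∑ i, stag N i • f i := by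
  induction m generalizing f with
  | zero => simp
  | succ m ih =>
    have h := sum_stag_smul_add_one hN fun i => f (i + m)
    rw [ih] at h
    rw [pow_succ, mul_neg_one, neg_smul, ← h]
    refine Finset.sum_congr rfl fun i _ => ?_
    rw [Nat.cast_succ, add_right_comm, add_assoc]

/-- The hopping contributions cancel in pairs, leaving only the linear term. -/
theorem hopDerivation_sum_stag {N : ℕ} [NeZero N] (hN : Even N) (c : ℂ) (m : ℕ) :
    hopDerivation N c (∑ i : ZMod N, stag N i • (X i * X (i + m)))
      = (c * (1 + (-1) ^ m)) • ∑ i : ZMod N, stag N i • X i := by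
  have h₁ := sum_stag_smul_add_one hN fun i : ZMod N =>
    (X (i - 1) * X (i + m) : MvPolynomial (ZMod N) ℂ)
  have h₂ := sum_stag_smul_add_one hN fun i : ZMod N =>
    (X i * X (i + m - 1) : MvPolynomial (ZMod N) ℂ)
  have h₃ := sum_stag_smul_add_natCast hN m fun i : ZMod N =>
    (X i : MvPolynomial (ZMod N) ℂ)
  simp only [add_sub_cancel_right, add_right_comm _ (1 : ZMod N)] at h₁ h₂
  have h : ∀ i : ZMod N, hopDerivation N c (stag N i • (X i * X (i + m)))
      = stag N i • (X (i - 1) * X (i + m)) + stag N i • (X i * X (i + m + 1))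
        + (stag N i • (X i * X (i + m - 1)) + stag N i • (X (i + 1) * X (i + m)))
        + c • (stag N i • X i + stag N i • X (i + m)) := by
    intro i
    rw [Derivation.map_smul]
    simp only [Derivation.leibniz, hopDerivation_X, smul_eq_mul, smul_eq_C_mul]
    ring_nf
  simp only [map_sum, h, Finset.sum_add_distrib, ← Finset.smul_sum, h₁, h₂, h₃]
  module

/-- A derivation plus a multiplication operator commutes with multiplication by any element
of the kernel of the derivation. -/
theorem lie_mulLeft_derivation_add_mulLeft {R A : Type*} [CommRing R] [CommRing A] [Algebra R A]
    (D : Derivation R A A) (p : A) {q : A} (hq : D q = 0) :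
    ⁅LinearMap.mulLeft R q, (D : A →ₗ[R] A) + LinearMap.mulLeft R p⁆ = 0 := by
  ext f
  simp only [Ring.lie_def, LinearMap.sub_apply, Module.End.mul_apply, LinearMap.add_apply,
    LinearMap.mulLeft_apply, Derivation.coeFn_coe, Derivation.leibniz, hq, smul_eq_mul,
    LinearMap.zero_apply]
  ring

/-- The model `g = Σ_x c_{x0}(b†)^x + c₀₁ b` possesses staggered `k`-local charges
for every `3 ≤ k ≤ N/2` when `N` is even. -/
theorem staggered_k_local_charge (N k M : ℕ) [NeZero N]
    (hNeven : Even N) (hN : 6 ≤ N) (hk : 3 ≤ k) (hkN : 2 * k ≤ N)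
    (c : ℕ → ℂ) (c01 : ℂ)
    (H Q : Module.End ℂ (MvPolynomial (ZMod N) ℂ))
    (hH : H = ∑ i : ZMod N,
        (ad N i * an N (i + 1) + ad N (i + 1) * an N i
          + ∑ x ∈ Finset.Icc 1 M, c x • (ad N i) ^ x + c01 • an N i))
    (hQ : Q = if Even k then
          ∑ i : ZMod N, stag N i • (ad N i * ad N (i + ((k - 1 : ℕ) : ZMod N)))
        else
          ∑ i : ZMod N, stag N i •
            (ad N i * ad N (i + ((k - 1 : ℕ) : ZMod N)) - (ad N i) ^ 2)) :
    ⁅Q, H⁆ = 0 := by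
  have hH' : H = (hopDerivation N c01 : _ →ₗ[ℂ] _) + LinearMap.mulLeft ℂ
      (∑ i : ZMod N, ∑ x ∈ Finset.Icc 1 M, c x • (X i : MvPolynomial (ZMod N) ℂ) ^ x) := by
    rw [hH]
    refine LinearMap.ext fun f => ?_
    simp only [ad, an, LinearMap.pow_mulLeft, LinearMap.sum_apply, LinearMap.add_apply,
      LinearMap.smul_apply, Module.End.mul_apply, LinearMap.mulLeft_apply,
      Derivation.coeFn_coe, hopDerivation_apply, Finset.sum_mul, smul_mul_assoc,
      Finset.sum_add_distrib]
    abel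
  let q (m : ℕ) : MvPolynomial (ZMod N) ℂ := ∑ i : ZMod N, stag N i • (X i * X (i + m))
  have hD (m : ℕ) := hopDerivation_sum_stag hNeven c01 m
  obtain ⟨m, rfl⟩ : ∃ m, k = m + 1 := ⟨k - 1, by omega⟩
  rw [Nat.add_sub_cancel] at hQ
  split_ifs at hQ with hke
  · have hQ' : Q = LinearMap.mulLeft ℂ (q m) := by
      rw [hQ]
      refine LinearMap.ext fun f => ?_
      simp [q, ad, Finset.sum_mul, mul_assoc]
    have hm : Odd m := by simpa [Nat.even_add_one] using hke
    rw [hQ', hH']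
    refine lie_mulLeft_derivation_add_mulLeft _ _ ?_
    rw [hD, hm.neg_one_pow]
    simp
  · have hQ' : Q = LinearMap.mulLeft ℂ (q m - q 0) := by
      rw [hQ]
      refine LinearMap.ext fun f => ?_
      simp [q, ad, Finset.sum_mul, mul_assoc, sub_mul, smul_sub, pow_two]
    have hm : Even m := by simpa [Nat.even_add_one] using hke
    rw [hQ', hH']
    refine lie_mulLeft_derivation_add_mulLeft _ _ ?_
    rw [map_sub, hD, hD, hm.neg_one_pow, pow_zero, sub_self]

end
end

section
/- Let N be an even integer with N ≥ 6, let M ∈ ℕ, and let c₁₀, …, c_{M0}, c₀₁, c₀₂ ∈ ℂ. On R_N := MvPolynomial (ZMod N) ℂ set g_i := Σ_{x=1}^{M} c_{x0}·(a†_i)^x + c₀₁·a_i + c₀₂·(a_i)² and H := Σ_i ( a†_i∘a_{i+1} + a†_{i+1}∘a_i + g_i ). Define Q₃ := Σ_i (−1)^i·( a†_i∘a†_{i+2} + c₀₂·( a†_i∘a_{i+1} − a†_{i+1}∘a_i ) + (a†_i)² − c₀₂·g_i + 2c₀₁·a†_i ). Then ⁅Q₃, H⁆ = 0; i.e., this model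 possesses a staggered 3-local conserved charge. -/
open MvPolynomial

noncomputable section

namespace BosonChain

section Stagger

variable {N : ℕ} [NeZero N]

lemma stag_add_one (hN : Even N) (i : ZMod N) : stag N (i + 1) = -stag N i := by
  have h1 : Nat.ModEq 2 (i + 1).val (i.val + 1) := by
    have h : Nat.ModEq N (i + 1).val (i.val + 1) := by
      rw [← ZMod.natCast_eq_natCast_iff]
      simp
    exact h.of_dvd hN.two_dvd
  have h2 : (-1 : ℂ) ^ (i + 1).val = (-1) ^ (i.val + 1) := by
    rw [neg_one_pow_eq_pow_mod_two, h1, ← neg_one_pow_eq_pow_mod_two]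
  simp [stag, h2, pow_succ]

/-- A staggered sum of `F i + F (i + 1)` telescopes to zero around the chain. -/
lemma sum_stag_smul_add_shift {V : Type*} [AddCommGroup V] [Module ℂ V] (hN : Even N)
    (F : ZMod N → V) : ∑ i, stag N i • (F i + F (i + 1)) = 0 := by
  have h : ∑ i, stag N i • F i = ∑ i, stag N (i + 1) • F (i + 1) :=
    (Equiv.sum_comp (Equiv.addRight (1 : ZMod N)) fun i => stag N i • F i).symm
  simp_rw [smul_add, Finset.sum_add_distrib, h, stag_add_one hN]
  simp

end Stagger

section Commutators

attribute [local instance] LieRing.ofAssociativeRing LieAlgebra.ofAssociativeAlgebra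

variable {N : ℕ} [NeZero N] {R : Type*} [Ring R] {A B : ZMod N → R}

lemma lie_mul_right (x y z : R) : ⁅x, y * z⁆ = ⁅x, y⁆ * z + y * ⁅x, z⁆ := by
  simp only [Ring.lie_def]; noncomm_ring

lemma lie_mul_left (x y z : R) : ⁅x * y, z⁆ = x * ⁅y, z⁆ + ⁅x, z⁆ * y := by
  simp only [Ring.lie_def]; noncomm_ring

/-- Hopping part of the Hamiltonian. -/
def hop (A B : ZMod N → R) : R := ∑ i, (A i * B (i + 1) + A (i + 1) * B i)

lemma hop_lie_of_commute {C Y : R} {j : ZMod N} (hA : ∀ i, ⁅A i, C⁆ = 0)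
    (hB : ∀ i, ⁅B i, C⁆ = if i = j then Y else 0) :
    ⁅hop A B, C⁆ = (A (j - 1) + A (j + 1)) * Y := by
  simp only [hop, sum_lie, add_lie, lie_mul_left, hA, hB,
    zero_mul, add_zero, mul_ite, mul_zero, Finset.sum_add_distrib, ← eq_sub_iff_add_eq,
    Finset.sum_ite_eq', Finset.mem_univ, if_true, add_mul]

lemma hop_lie_annihilation (hBB : ∀ i j, ⁅B i, B j⁆ = 0)
    (hBA : ∀ i j, ⁅B i, A j⁆ = if i = j then 1 else 0) (j : ZMod N) :
    ⁅hop A B, B j⁆ = -(B (j - 1) + B (j + 1)) := by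
  have hAB (i j) : ⁅A i, B j⁆ = if i = j then -1 else 0 := by
    rw [← lie_skew, hBA]
    rcases eq_or_ne i j with rfl | h
    · simp
    · simp [h, h.symm]
  simp only [hop, sum_lie, add_lie, lie_mul_left, hAB, hBB,
    mul_zero, zero_add, ite_mul, zero_mul, Finset.sum_add_distrib, ← eq_sub_iff_add_eq,
    Finset.sum_ite_eq', Finset.mem_univ, if_true, neg_one_mul]
  abel

variable [Algebra ℂ R]

/-- The conservation law for a chain of canonical pairs, where `P i` is an on-site potential
in the creation operators and `P' i` its derivative. -/
theorem staggered_charge_conserved (hNeven : Even N) (hN : 6 ≤ N) (c01 c02 : ℂ)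
    {P P' g : ZMod N → R}
    (hAA : ∀ i j, ⁅A i, A j⁆ = 0) (hBB : ∀ i j, ⁅B i, B j⁆ = 0)
    (hAP : ∀ i j, ⁅A i, P j⁆ = 0) (hPP : ∀ i j, ⁅P i, P j⁆ = 0)
    (hBA : ∀ i j, ⁅B i, A j⁆ = if i = j then 1 else 0)
    (hBP : ∀ i j, ⁅B i, P j⁆ = if i = j then P' j else 0)
    (hg : ∀ i, g i = P i + c01 • B i + c02 • B i ^ 2) :
    ⁅∑ i, stag N i • (A i * A (i + 2) + c02 • (A i * B (i + 1) - A (i + 1) * B i)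
        + A i ^ 2 - c02 • g i + (2 * c01) • A i),
      ∑ i, (A i * B (i + 1) + A (i + 1) * B i + g i)⁆ = 0 := by
  have hPA (i j) : ⁅P i, A j⁆ = 0 := by rw [← lie_skew, hAP, neg_zero]
  have hPB (i j) : ⁅P i, B j⁆ = if i = j then -P' i else 0 := by
    rw [← lie_skew, hBP]
    rcases eq_or_ne i j with rfl | h
    · simp
    · simp [h, h.symm]
  have hgg (i j) : ⁅g i, g j⁆ = 0 := by
    by_cases hij : i = j
    · rw [hij, lie_self]
    · simp only [hg, add_lie, lie_add, smul_lie, lie_smul, pow_two, lie_mul_left, lie_mul_right,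
        hPP, hPB, hBP, hBB, if_neg hij]
      simp
  have hgA (i j) : ⁅g i, A j⁆ = if i = j then c01 • 1 + (2 * c02) • B i else 0 := by
    simp only [hg, add_lie, smul_lie, pow_two, lie_mul_left, hPA, hBA]
    split_ifs
    · simp only [mul_one, one_mul]; module
    · simp
  have hgB (i j) : ⁅g i, B j⁆ = if i = j then -P' i else 0 := by
    simp only [hg, add_lie, smul_lie, pow_two, lie_mul_left, hPB, hBB]
    simp
  set H := ∑ i, (A i * B (i + 1) + A (i + 1) * B i + g i) with hH
  replace hH : H = hop A B + ∑ i, g i := by rw [hH, hop, ← Finset.sum_add_distrib]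
  have hHA (j) : ⁅H, A j⁆ = A (j - 1) + A (j + 1) + c01 • 1 + (2 * c02) • B j := by
    rw [hH, add_lie, hop_lie_of_commute (fun i => hAA i j) (fun i => hBA i j), sum_lie]
    simp [hgA, add_assoc]
  have hHB (j) : ⁅H, B j⁆ = -(B (j - 1) + B (j + 1)) - P' j := by
    rw [hH, add_lie, hop_lie_annihilation hBB hBA, sum_lie]
    simp [hgB, sub_eq_add_neg]
  have hHg (j) : ⁅H, g j⁆ = (A (j - 1) + A (j + 1)) * P' j - c01 • (B (j - 1) + B (j + 1))
      - c02 • ((B (j - 1) + B (j + 1)) * B j + B j * (B (j - 1) + B (j + 1))) := by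
    rw [hH, add_lie, sum_lie, Finset.sum_eq_zero (fun i _ => hgg i j), hg, lie_add, lie_add,
      lie_smul, lie_smul, pow_two, lie_mul_right, hop_lie_annihilation hBB hBA,
      hop_lie_of_commute (fun i => hAP i j) (fun i => hBP i j)]
    simp only [neg_mul, mul_neg]
    module
  have hBBc (i j) : B i * B j = B j * B i := sub_eq_zero.mp (hBB i j)
  have hAAc (i j) : A i * A j = A j * A i := sub_eq_zero.mp (hAA i j)
  have hBAs (i) : B i * A i = A i * B i + 1 := by
    have := hBA i i
    rw [if_pos rfl, Ring.lie_def] at this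
    rw [← this]; abel
  have hBA2 (i) : B i * A (i + 2) = A (i + 2) * B i := by
    have h2 : i ≠ i + 2 := by
      intro h
      have h0 : ((2 : ℕ) : ZMod N) = 0 := by simpa using h
      have := Nat.le_of_dvd two_pos ((ZMod.natCast_eq_zero_iff 2 N).mp h0)
      omega
    have := hBA i (i + 2)
    rw [if_neg h2] at this
    exact sub_eq_zero.mp this
  let F : ZMod N → R := fun i =>
    A (i - 1) * A (i + 2) + A i * A (i + 1) + (2 : ℂ) • (A (i - 1) * A i)
    + c02 • 1 + (c01 * c01) • 1
    + c01 • (A (i + 1) + (2 : ℂ) • A (i - 1) + A i)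
    + c02 • (A (i + 1) * B (i - 1) + A (i - 1) * B (i + 1) + (2 : ℂ) • (A i * B i))
    - c02 • (A (i - 1) * P' i)
    + (c02 * c01) • (B (i - 1) + (2 : ℂ) • B i)
    + (c02 * c02 * 2) • (B (i - 1) * B i)
  rw [← lie_skew, neg_eq_zero, lie_sum, ← sum_stag_smul_add_shift hNeven F]
  refine Finset.sum_congr rfl fun i _ => ?_
  have e1 : i + 1 - 1 = i := by ring
  have e2 : i + 2 - 1 = i + 1 := by ring
  have e3 : i + 1 + 1 = i + 2 := by ring
  have e4 : i + 1 + 2 = i + 3 := by ring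
  have e5 : i + 2 + 1 = i + 3 := by ring
  rw [lie_smul]
  congr 1
  simp only [F, lie_add, lie_sub, lie_smul, pow_two, lie_mul_right, hHA, hHB, hHg,
    e1, e2, e3, e4, e5, mul_add, add_mul, mul_sub, mul_neg, smul_mul_assoc,
    mul_smul_comm, mul_one, one_mul, hBAs, hBA2, hBBc (i + 1) i, hBBc i (i - 1),
    hAAc (i + 1) i, hAAc i (i - 1)]
  module

end Commutators

/-- Commutator of a partial derivative with a multiplication operator. -/
lemma an_lie_mulLeft (N : ℕ) (i : ZMod N) (p : MvPolynomial (ZMod N) ℂ) :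
    ⁅an N i, LinearMap.mulLeft ℂ p⁆ = LinearMap.mulLeft ℂ (pderiv i p) := by
  refine LinearMap.ext fun f => ?_
  simp [Ring.lie_def, an, Derivation.leibniz, mul_comm]

lemma mulLeft_lie_mulLeft {S : Type*} [CommRing S] [Algebra ℂ S] (p q : S) :
    ⁅LinearMap.mulLeft ℂ p, LinearMap.mulLeft ℂ q⁆ = 0 := by
  refine LinearMap.ext fun f => ?_
  simp [Ring.lie_def, mul_left_comm]

lemma pderiv_lie_pderiv {σ : Type*} (i j : σ) :
    ⁅pderiv (R := ℂ) i, pderiv (R := ℂ) j⁆ = 0 := by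
  classical
  refine MvPolynomial.derivation_ext fun k => ?_
  simp [Derivation.commutator_apply, pderiv_X, Pi.single_apply, apply_ite]

lemma an_lie_an (N : ℕ) (i j : ZMod N) : ⁅an N i, an N j⁆ = 0 := by
  refine LinearMap.ext fun f => ?_
  simpa [Derivation.commutator_apply, Ring.lie_def, an] using
    DFunLike.congr_fun (pderiv_lie_pderiv i j) f

lemma an_lie_ad (N : ℕ) (i j : ZMod N) :
    ⁅an N i, ad N j⁆ = if i = j then 1 else 0 := by
  rw [ad, an_lie_mulLeft]
  split_ifs with h
  · rw [h, pderiv_X_self, LinearMap.mulLeft_one]; rfl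
  · rw [pderiv_X_of_ne (Ne.symm h), LinearMap.mulLeft_zero_eq_zero]

/-- The on-site potential as a polynomial. -/
def potential (N M : ℕ) (c : ℕ → ℂ) (i : ZMod N) : MvPolynomial (ZMod N) ℂ :=
  ∑ x ∈ Finset.Icc 1 M, c x • X i ^ x

lemma mulLeft_potential (N M : ℕ) (c : ℕ → ℂ) (i : ZMod N) :
    LinearMap.mulLeft ℂ (potential N M c i) = ∑ x ∈ Finset.Icc 1 M, c x • ad N i ^ x := by
  refine LinearMap.ext fun f => ?_
  simp [potential, ad, LinearMap.pow_mulLeft, Finset.sum_mul, LinearMap.sum_apply]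

lemma pderiv_potential_of_ne (N M : ℕ) (c : ℕ → ℂ) {i j : ZMod N} (h : i ≠ j) :
    pderiv i (potential N M c j) = 0 := by
  simp [potential, Derivation.leibniz_pow, pderiv_X_of_ne h.symm]

end BosonChain

open BosonChain

/-- The model with on-site term `g = Σ_x c_{x0}(b†)^x + c₀₁ b + c₀₂ b²` possesses
the displayed staggered 3-local conserved charge `Q₃`. -/
theorem staggered_three_local_charge (N M : ℕ) [NeZero N]
    (hNeven : Even N) (hN : 6 ≤ N)
    (c : ℕ → ℂ) (c01 c02 : ℂ)
    (g : ZMod N → Module.End ℂ (MvPolynomial (ZMod N) ℂ))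
    (hg : ∀ i, g i = ∑ x ∈ Finset.Icc 1 M, c x • (ad N i) ^ x
        + c01 • an N i + c02 • (an N i) ^ 2)
    (H Q3 : Module.End ℂ (MvPolynomial (ZMod N) ℂ))
    (hH : H = ∑ i : ZMod N,
        (ad N i * an N (i + 1) + ad N (i + 1) * an N i + g i))
    (hQ : Q3 = ∑ i : ZMod N, stag N i •
        (ad N i * ad N (i + 2)
          + c02 • (ad N i * an N (i + 1) - ad N (i + 1) * an N i)
          + (ad N i) ^ 2 - c02 • g i + (2 * c01) • ad N i)) :
    ⁅Q3, H⁆ = 0 := by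
  subst hH hQ
  refine staggered_charge_conserved hNeven hN c01 c02
    (P := fun i => LinearMap.mulLeft ℂ (potential N M c i))
    (P' := fun i => LinearMap.mulLeft ℂ (pderiv i (potential N M c i)))
    (fun _ _ => mulLeft_lie_mulLeft _ _) (an_lie_an N) (fun _ _ => mulLeft_lie_mulLeft _ _)
    (fun _ _ => mulLeft_lie_mulLeft _ _) (an_lie_ad N) (fun i j => ?_) fun i => ?_
  · rw [an_lie_mulLeft]
    split_ifs with h
    · rw [h]
    · rw [pderiv_potential_of_ne N M c h, LinearMap.mulLeft_zero_eq_zero]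
  · rw [hg, mulLeft_potential]

end
end
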